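/- (Desnanot–Jacobi / Dodgson condensation) For an n×n matrix M over a commutative ring with n ≥ 2, det(M)·det(M with rows 1,n and columns 1,n removed) = det(M^{1}_{1})·det(M^{n}_{n}) − det(M^{1}_{n})·det(M^{n}_{1}), where M^{i}_{j} denotes M with row i and column j removed. -/

import Mathlib

namespace Matrix

variable {R : Type*} [CommRing R] {l m : Type*} [Fintype l] [Fintype m]
  [DecidableEq l] [DecidableEq m]

/-- Jacobi's complementary minor formula, multiplied by the determinant. -/
theorem det_mul_det_adjugate_toBlocks₁₁ (M : Matrix (l ⊕ m) (l ⊕ m) R) :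
    M.det * M.adjugate.toBlocks₁₁.det = M.det ^ Fintype.card l * M.toBlocks₂₂.det := by
  have hadj := M.mul_adjugate
  rw [← fromBlocks_toBlocks M.adjugate] at hadj
  nth_rewrite 1 [← fromBlocks_toBlocks M] at hadj
  rw [fromBlocks_multiply, ← fromBlocks_one, fromBlocks_smul, fromBlocks_inj] at hadj
  have hmul : M * fromBlocks M.adjugate.toBlocks₁₁ 0 M.adjugate.toBlocks₂₁ 1 =
      fromBlocks (M.det • 1) M.toBlocks₁₂ 0 M.toBlocks₂₂ := by
    nth_rewrite 1 [← fromBlocks_toBlocks M]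
    rw [fromBlocks_multiply, hadj.1, hadj.2.2.1]
    simp
  simpa [det_fromBlocks_zero₁₂, det_fromBlocks_zero₂₁] using congrArg det hmul

/-- Jacobi's complementary minor formula for two rows and columns. -/
theorem det_adjugate_toBlocks₁₁_fin_two (M : Matrix (Fin 2 ⊕ m) (Fin 2 ⊕ m) R) :
    M.adjugate.toBlocks₁₁.det = M.det * M.toBlocks₂₂.det := by
  let X := mvPolynomialX (Fin 2 ⊕ m) (Fin 2 ⊕ m) ℤ
  have hX : X.adjugate.toBlocks₁₁.det = X.det * X.toBlocks₂₂.det := by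
    refine mul_left_cancel₀ (det_mvPolynomialX_ne_zero (Fin 2 ⊕ m) ℤ) ?_
    rw [det_mul_det_adjugate_toBlocks₁₁, Fintype.card_fin, sq, mul_assoc]
  let f : MvPolynomial ((Fin 2 ⊕ m) × (Fin 2 ⊕ m)) ℤ →+* R :=
    (MvPolynomial.aeval fun p => M p.1 p.2).toRingHom
  have hf : f.mapMatrix X = M := mvPolynomialX_mapMatrix_aeval ℤ M
  have h := congrArg f hX
  rw [map_mul, f.map_det, f.map_det, f.map_det, hf] at h
  have h₁₁ : f.mapMatrix X.adjugate.toBlocks₁₁ = M.adjugate.toBlocks₁₁ := by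
    rw [← hf, ← f.map_adjugate]
    rfl
  have h₂₂ : f.mapMatrix X.toBlocks₂₂ = M.toBlocks₂₂ := by
    rw [← hf]
    rfl
  rwa [h₁₁, h₂₂] at h

end Matrix

/-- The decomposition of `Fin (n + 2)` into its two end points and its interior. -/
noncomputable def finEndsSumInteriorEquiv (n : ℕ) : Fin 2 ⊕ Fin n ≃ Fin (n + 2) :=
  Equiv.ofBijective
    (Sum.elim ![0, Fin.last (n + 1)] fun t : Fin n => t.succ.castSucc) <| by
    rw [Fintype.bijective_iff_injective_and_card]
    refine ⟨Function.Injective.sumElim ?_ ?_ ?_, by simp [add_comm]⟩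
    · intro i j h
      fin_cases i <;> fin_cases j <;> simp_all [Fin.ext_iff]
    · intro i j h
      simpa using h
    · intro i t h
      have ht := t.isLt
      fin_cases i <;> simp [Fin.ext_iff] at h
      lia

/-- Desnanot–Jacobi / Dodgson condensation: for an `(n+2)×(n+2)` matrix `M` over a
commutative ring, `det M · det (inner minor) = det M¹₁ · det Mⁿ₍ₙ₎ − det M¹₍ₙ₎ · det Mⁿ₁`,
where `Mⁱⱼ` denotes `M` with row `i` and column `j` removed and the inner minor removes
both the first and last rows and columns. -/
theorem desnanot_jacobi {R : Type*} [CommRing R] (n : ℕ)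
    (M : Matrix (Fin (n + 2)) (Fin (n + 2)) R) :
    M.det * (M.submatrix (fun t : Fin n => t.succ.castSucc)
        (fun t : Fin n => t.succ.castSucc)).det =
      (M.submatrix (Fin.succAbove 0) (Fin.succAbove 0)).det *
        (M.submatrix (Fin.succAbove (Fin.last (n + 1)))
          (Fin.succAbove (Fin.last (n + 1)))).det -
      (M.submatrix (Fin.succAbove 0) (Fin.succAbove (Fin.last (n + 1)))).det *
        (M.submatrix (Fin.succAbove (Fin.last (n + 1))) (Fin.succAbove 0)).det := by
  have h := Matrix.det_adjugate_toBlocks₁₁_fin_two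
    (M.submatrix (finEndsSumInteriorEquiv n) (finEndsSumInteriorEquiv n))
  rw [Matrix.adjugate_submatrix_equiv_self, Matrix.det_submatrix_equiv_self,
    Matrix.det_fin_two] at h
  change M.adjugate 0 0 * M.adjugate (Fin.last (n + 1)) (Fin.last (n + 1)) -
    M.adjugate 0 (Fin.last (n + 1)) * M.adjugate (Fin.last (n + 1)) 0 =
      M.det * (M.submatrix (fun t : Fin n => t.succ.castSucc)
        (fun t : Fin n => t.succ.castSucc)).det at h
  have hsign : ((-1 : R) ^ (n + 1)) * (-1) ^ (n + 1) = 1 := by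
    rw [← mul_pow]
    simp
  simp only [Matrix.adjugate_fin_succ_eq_det_submatrix, Fin.val_last, Fin.val_zero, add_zero,
    zero_add, pow_zero, one_mul, pow_add _ (n + 1) (n + 1), hsign] at h
  rw [← h]
  linear_combination
    -(M.submatrix (Fin.succAbove 0) (Fin.succAbove (Fin.last (n + 1)))).det *
      (M.submatrix (Fin.succAbove (Fin.last (n + 1))) (Fin.succAbove 0)).det * hsign
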